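/- Let q = 2^k with k ≥ 1, let H = {(x,y) ∈ F_{q^2}^2 : x^{q+1} = y^q + y}, and let C be the Hermitian lifted code, i.e. the F_{q^2}-subspace of functions H → F_{q^2} spanned by the evaluations on H of all good polynomials f ∈ F_{q^2}[X,Y] (f is good if for all a, b ∈ F_{q^2} with a^{q+1} + b^q + b ≠ 0 there exists a univariate polynomial g of degree less than q with f(x, ax+b) = g(x) for all x with (x, ax+b) ∈ H). Then the dimension K of C over F_{q^2} satisfies K ≥ Σ_{r=1}^{k} (q/2^{r+1})·( C(q/2^r, 2)·(4^r - 3^r) + (q/2^r)·C(2^r + 1, 2) ), where C(n,2) denotes the binomial coefficient n choose 2. -/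

import Mathlib

/-- A bivariate polynomial `f` over `F` is *good* (w.r.t. `q`) if for every line `L_{a,b}` of the
Hermitian curve (i.e. `a, b` with `a^{q+1} + b^q + b ≠ 0`) there is a univariate polynomial `g`
of degree less than `q` such that `f` agrees with `g(x)` at every point `(x, ax+b)` of the
Hermitian curve. -/
def IsGoodPoly (q : ℕ) {F : Type*} [Field F] (f : MvPolynomial (Fin 2) F) : Prop :=
  ∀ a b : F, a ^ (q + 1) + b ^ q + b ≠ 0 →
    ∃ g : Polynomial F, g.degree < (q : WithBot ℕ) ∧
      ∀ x y : F, x ^ (q + 1) = y ^ q + y → y = a * x + b →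
        MvPolynomial.eval ![x, y] f = Polynomial.eval x g

open Polynomial in
/-- The functions `F → F` which agree on the solutions of `u ^ (q + 1) = γ` with a polynomial of
degree less than `q`. -/
def lowDegreeOnCircle (q : ℕ) {F : Type*} [Field F] (γ : F) : Submodule F (F → F) where
  carrier := {h | ∃ g : F[X], g.degree < (q : WithBot ℕ) ∧ ∀ u, u ^ (q + 1) = γ → h u = g.eval u}
  add_mem' := by
    rintro h₁ h₂ ⟨g₁, hg₁, e₁⟩ ⟨g₂, hg₂, e₂⟩
    refine ⟨g₁ + g₂, (degree_add_le _ _).trans_lt (max_lt hg₁ hg₂), fun u hu => ?_⟩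
    simp [e₁ u hu, e₂ u hu]
  zero_mem' := ⟨0, by simp, by simp⟩
  smul_mem' := by
    rintro c h ⟨g, hg, e⟩
    refine ⟨C c * g, ?_, fun u hu => by simp [e u hu]⟩
    rw [← smul_eq_C_mul]
    exact (degree_smul_le c g).trans_lt hg

open Polynomial in
lemma pow_mem_lowDegreeOnCircle {q : ℕ} {F : Type*} [Field F] (γ : F) {n : ℕ}
    (hn : n % (q + 1) ≠ q) : (fun u : F => u ^ n) ∈ lowDegreeOnCircle q γ := by
  have hlt : n % (q + 1) < q := by
    have := Nat.mod_lt n q.add_one_pos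
    omega
  refine ⟨C (γ ^ (n / (q + 1))) * X ^ (n % (q + 1)), ?_, fun u hu => ?_⟩
  · exact (degree_C_mul_X_pow_le _ _).trans_lt (by exact_mod_cast hlt)
  · simp only [eval_mul, eval_C, eval_pow, eval_X]
    rw [← hu, ← pow_mul, ← pow_add, Nat.div_add_mod]

open Polynomial in
lemma eval_mul_eval_pow_mem_lowDegreeOnCircle {q D : ℕ} {F : Type*} [Field F] (γ : F)
    {R₁ R₂ R₃ : F[X]} {A B N : ℕ} (h₁ : R₁.natDegree ≤ A) (h₂ : R₂.natDegree ≤ B)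
    (h₃ : R₃.natDegree ≤ N) (hA : A + 2 ≤ D) (hAB : D * B + A + 2 ≤ q) (hN : D * N < q) :
    (fun u : F => R₁.eval u * R₂.eval (u ^ D) * R₃.eval (u ^ (q * D))) ∈
      lowDegreeOnCircle q γ := by
  have key : (fun u : F => R₁.eval u * R₂.eval (u ^ D) * R₃.eval (u ^ (q * D))) =
      ∑ s ∈ Finset.range (A + 1), ∑ v ∈ Finset.range (B + 1), ∑ w ∈ Finset.range (N + 1),
        (R₁.coeff s * R₂.coeff v * R₃.coeff w) • fun u : F => u ^ (s + D * v + q * D * w) := by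
    funext u
    simp only [Finset.sum_apply, Pi.smul_apply, smul_eq_mul]
    rw [eval_eq_sum_range' (Nat.lt_succ_of_le h₁), eval_eq_sum_range' (Nat.lt_succ_of_le h₂),
      eval_eq_sum_range' (Nat.lt_succ_of_le h₃), Finset.sum_mul_sum, Finset.sum_mul]
    refine Finset.sum_congr rfl fun s _ => ?_
    rw [Finset.sum_mul_sum]
    refine Finset.sum_congr rfl fun v _ => Finset.sum_congr rfl fun w _ => ?_
    rw [← pow_mul, ← pow_mul, pow_add, pow_add]
    ring
  rw [key]
  refine Submodule.sum_mem _ fun s hs => Submodule.sum_mem _ fun v hv => Submodule.sum_mem _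
    fun w hw => Submodule.smul_mem _ _ (pow_mem_lowDegreeOnCircle γ fun hmod => ?_)
  rw [Finset.mem_range] at hs hv hw
  have hdiv := Nat.div_add_mod (s + D * v + q * D * w) (q + 1)
  rw [hmod] at hdiv
  generalize (s + D * v + q * D * w) / (q + 1) = z at hdiv
  have hDv : D * v ≤ D * B := Nat.mul_le_mul_left _ (by omega)
  have hDw : D * w ≤ D * N := Nat.mul_le_mul_left _ (by omega)
  have hs1 : s + 1 + D * v = D * w := by
    have e : ((s : ℤ) + 1 + D * v - D * w) = (q + 1) * (z + 1 - D * w) := by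
      zify at hdiv
      linear_combination -hdiv
    zify at hDv hDw hAB hN hs hv hw ⊢
    have h1 : (z : ℤ) + 1 - D * w < 1 := by
      by_contra hcon
      push Not at hcon
      nlinarith
    have h2 : -1 < (z : ℤ) + 1 - D * w := by
      by_contra hcon
      push Not at hcon
      nlinarith [mul_nonneg (Nat.cast_nonneg (α := ℤ) D) (Nat.cast_nonneg (α := ℤ) v)]
    have h3 : (z : ℤ) + 1 - D * w = 0 := by omega
    rw [h3] at e
    linarith
  have hdvd : D ∣ s + 1 := (Nat.dvd_add_left (Dvd.intro v rfl)).1 (hs1 ▸ Dvd.intro w rfl)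
  have := Nat.le_of_dvd (Nat.succ_pos s) hdvd
  omega

open Polynomial in
/-- A sufficient condition for a monomial `X ^ i * Y ^ j` to be good. -/
lemma isGoodPoly_monomial {k q : ℕ} (hq : q = 2 ^ k) {F : Type*} [Field F] [Fintype F]
    (hF : Fintype.card F = q ^ 2) {c i₀ j₀ i₁ j₁ : ℕ} (hi : i₀ % 2 ^ (c + 1) < 2 ^ c)
    (hj : j₀ % 2 ^ (c + 1) < 2 ^ c) (hij : i₀ + j₀ + 2 ≤ q) (hi₁ : 2 ^ (c + 1) ∣ i₁)
    (hj₁ : 2 ^ (c + 1) ∣ j₁) (hij₁ : i₁ + j₁ < q) :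
    IsGoodPoly q (MvPolynomial.X 0 ^ (i₀ + q * i₁) * MvPolynomial.X 1 ^ (j₀ + q * j₁) :
      MvPolynomial (Fin 2) F) := by
  have : Fact (Nat.Prime 2) := ⟨Nat.prime_two⟩
  have : CharP F 2 := charP_of_card_eq_prime_pow (f := k * 2) (by rw [hF, hq, pow_mul])
  intro a b _
  set α := a ^ q with hα
  set δ := a * α + b with hδ
  set D := 2 ^ (c + 1) with hD
  obtain ⟨n, rfl⟩ := hi₁
  obtain ⟨l, rfl⟩ := hj₁
  have hDD : D = 2 * 2 ^ c := by rw [hD, pow_succ, mul_comm]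
  have hdivi := Nat.div_add_mod i₀ D
  have hdivj := Nat.div_add_mod j₀ D
  obtain ⟨g, hg, hgu⟩ := eval_mul_eval_pow_mem_lowDegreeOnCircle (q := q) (D := D)
    (a ^ (q + 1) + b ^ q + b)
    (R₁ := (X + C α) ^ (i₀ % D) * (C a * X + C δ) ^ (j₀ % D))
    (R₂ := (X + C (α ^ D)) ^ (i₀ / D) * (C (a ^ D) * X + C (δ ^ D)) ^ (j₀ / D))
    (R₃ := (X + C (α ^ (q * D))) ^ n * (C (a ^ (q * D)) * X + C (δ ^ (q * D))) ^ l)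
    (A := i₀ % D + j₀ % D) (B := i₀ / D + j₀ / D) (N := n + l)
    (by compute_degree) (by compute_degree) (by compute_degree) (by omega)
    (by rw [mul_add]; omega) (by rw [mul_add]; omega)
  have hpow : ∀ (x y : F) (t : ℕ), (x + y) ^ 2 ^ t = x ^ 2 ^ t + y ^ 2 ^ t :=
    fun x y t => add_pow_char_pow x y 2 t
  have hq2 : ∀ x : F, (x ^ q) ^ q = x := fun x => by
    rw [← pow_mul, ← sq, ← hF, FiniteField.pow_card]
  refine ⟨g.comp (X + C α), ?_, fun x y hxy hy => ?_⟩
  · by_cases hg0 : g.comp (X + C α) = 0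
    · simp [hg0]
    · rw [degree_eq_natDegree hg0, natDegree_comp, natDegree_X_add_C, mul_one]
      rcases eq_or_ne g 0 with rfl | h
      · simp at hg0
      · rwa [degree_eq_natDegree h] at hg
  · have two : (2 : F) = 0 := CharTwo.two_eq_zero
    have hu : (x + α) ^ (q + 1) = a ^ (q + 1) + b ^ q + b := by
      have e1 : (x + α) ^ q = x ^ q + a := by rw [hq, hpow, ← hq, hα, hq2]
      have e2 : y ^ q = α * x ^ q + b ^ q := by rw [hy, hq, hpow, mul_pow, ← hq]
      rw [e2] at hxy
      rw [pow_succ, e1]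
      rw [pow_succ] at hxy ⊢
      rw [← hα]
      linear_combination hxy + hy + (α * x ^ q + a * x) * two
    have := hgu _ hu
    simp only [eval_comp, eval_add, eval_X, eval_C, MvPolynomial.eval_mul, MvPolynomial.eval_pow,
      MvPolynomial.eval_X, Matrix.cons_val_zero, Matrix.cons_val_one]
    rw [← this]
    have hx : x = (x + α) + α := by linear_combination -α * two
    have hy' : y = a * (x + α) + δ := by rw [hy, hδ]; linear_combination -(a * α) * two
    generalize x + α = u at *
    rw [hx, hy']
    simp only [eval_mul, eval_pow, eval_add, eval_X, eval_C]
    have hqD : q * D = 2 ^ (k + (c + 1)) := by rw [hq, hD, ← pow_add]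
    rw [← mul_pow a, ← mul_pow a, hqD, ← hpow, ← hpow, hD, ← hpow, ← hpow, ← hD, ← hqD]
    nth_rewrite 1 [← hdivi]
    nth_rewrite 1 [← hdivj]
    simp only [pow_add, pow_mul, ← mul_assoc]
    ring

open Polynomial in
lemma card_norm_fiber {q : ℕ} (hq : 2 ≤ q) {F : Type*} [Field F] [Fintype F] [DecidableEq F]
    (hF : Fintype.card F = q ^ 2) {c : F} (hc : c ≠ 0) (hcq : c ^ q = c) :
    q < (Finset.univ.filter fun x : F => x ^ (q + 1) = c).card := by
  have hc1 : c ^ (q - 1) = 1 := by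
    apply mul_right_cancel₀ hc
    rw [← pow_succ, Nat.sub_add_cancel (by omega), hcq, one_mul]
  have hexp : q ^ 2 = (q + 1) * (q - 1) + 1 := by
    obtain ⟨p, rfl⟩ : ∃ p, q = p + 1 := ⟨q - 1, by omega⟩
    simp only [Nat.add_sub_cancel]
    ring
  have hdvd : (X ^ (q + 1) - C c : F[X]) ∣ X ^ Fintype.card F - X := by
    have h := sub_dvd_pow_sub_pow (X ^ (q + 1) : F[X]) (C c) (q - 1)
    rw [← C_pow, hc1, ← pow_mul, C_1] at h
    rw [hF, hexp, pow_succ]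
    have := h.mul_right X
    rwa [sub_mul, one_mul] at this
  have hne : (X ^ Fintype.card F - X : F[X]) ≠ 0 :=
    FiniteField.X_pow_card_sub_X_ne_zero F Fintype.one_lt_card
  have hsplits : (X ^ Fintype.card F - X : F[X]).Splits := by
    rw [splits_iff_card_roots, FiniteField.roots_X_pow_card_sub_X,
      FiniteField.X_pow_card_sub_X_natDegree_eq F Fintype.one_lt_card]
    rfl
  have hcard := (hsplits.of_dvd hne hdvd).natDegree_eq_card_roots
  rw [natDegree_X_pow_sub_C] at hcard
  have hnodup : (X ^ (q + 1) - C c : F[X]).roots.Nodup := by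
    refine Multiset.nodup_of_le (roots.le_of_dvd hne hdvd) ?_
    rw [FiniteField.roots_X_pow_card_sub_X]
    exact Finset.univ.nodup
  rw [← Multiset.toFinset_card_of_nodup hnodup] at hcard
  refine lt_of_lt_of_le (Nat.lt_succ_self q) (hcard.le.trans (Finset.card_le_card fun x hx => ?_))
  simpa [sub_eq_zero] using (mem_roots'.1 (Multiset.mem_toFinset.1 hx)).2

open Polynomial in
lemma card_trace_ne_zero {q : ℕ} (hq : 2 ≤ q) {F : Type*} [Field F] [Fintype F] [DecidableEq F]
    (hF : Fintype.card F = q ^ 2) :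
    q ^ 2 - q ≤ (Finset.univ.filter fun y : F => y ^ q + y ≠ 0).card := by
  have hdeg : (X ^ q + X : F[X]).natDegree = q := by
    rw [natDegree_add_eq_left_of_natDegree_lt, natDegree_X_pow]
    rw [natDegree_X_pow, natDegree_X]
    omega
  have hne : (X ^ q + X : F[X]) ≠ 0 := fun h => by
    rw [h, natDegree_zero] at hdeg
    omega
  have hle : (Finset.univ.filter fun y : F => y ^ q + y = 0).card ≤ q := by
    refine le_of_le_of_eq ?_ hdeg
    refine (Finset.card_le_card fun y hy => ?_).trans
      ((Multiset.toFinset_card_le (X ^ q + X : F[X]).roots).trans (card_roots' _))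
    rw [Multiset.mem_toFinset, mem_roots hne]
    simpa using hy
  have := Finset.card_filter_add_card_filter_not (s := (Finset.univ : Finset F))
    (fun y : F => y ^ q + y = 0)
  rw [Finset.card_univ, hF] at this
  simp only [ne_eq]
  omega

open Polynomial in
lemma eq_zero_of_sum_mul_pow_eq_zero {n : ℕ} {F : Type*} [Field F] (a : Fin n → F)
    (s : Finset F) (hs : n ≤ s.card) (h : ∀ x ∈ s, ∑ e, a e * x ^ (e : ℕ) = 0) (e : Fin n) :
    a e = 0 := by
  have hdeg := degree_sum_fin_lt a
  have hQ : ∑ e, C (a e) * X ^ (e : ℕ) = 0 := by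
    by_contra hne
    rw [degree_eq_natDegree hne, Nat.cast_lt] at hdeg
    refine hne (eq_zero_of_natDegree_lt_card_of_eval_eq_zero' _ s (fun x hx => ?_)
      (hdeg.trans_le hs))
    rw [eval_finsetSum]
    simpa using h x hx
  have := congrArg (fun P => coeff P (e : ℕ)) hQ
  simpa [finsetSum_coeff, coeff_X_pow, Fin.val_inj] using this

open Polynomial in
/-- Products of `x ^ e`, `e ≤ q`, with polynomials in `y` of distinct degrees less than `q ^ 2 - q`
are linearly independent as functions on the Hermitian curve. -/
lemma linearIndependent_hermitian {k q : ℕ} (hk : 1 ≤ k) (hq : q = 2 ^ k) {F : Type*} [Field F]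
    [Fintype F] (hF : Fintype.card F = q ^ 2) (p : Sequence F) :
    LinearIndependent F (fun z : Fin (q + 1) × Fin (q ^ 2 - q) =>
      fun P : {P : F × F // P.1 ^ (q + 1) = P.2 ^ q + P.2} =>
        P.1.1 ^ (z.1 : ℕ) * (p (z.2 : ℕ)).eval P.1.2) := by
  classical
  have : Fact (Nat.Prime 2) := ⟨Nat.prime_two⟩
  have : CharP F 2 := charP_of_card_eq_prime_pow (f := k * 2) (by rw [hF, hq, pow_mul])
  have hq2 : 2 ≤ q := by
    rw [hq]
    exact Nat.le_self_pow (by omega) 2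
  rw [Fintype.linearIndependent_iff]
  intro g hg
  have hpt : ∀ x y : F, x ^ (q + 1) = y ^ q + y →
      ∑ e : Fin (q + 1), (∑ d, g (e, d) * (p (d : ℕ)).eval y) * x ^ (e : ℕ) = 0 := by
    intro x y h
    have := congrFun hg ⟨(x, y), h⟩
    simp only [Finset.sum_apply, Pi.smul_apply, smul_eq_mul, Pi.zero_apply,
      Fintype.sum_prod_type] at this
    rw [← this]
    refine Finset.sum_congr rfl fun e _ => ?_
    rw [Finset.sum_mul]
    exact Finset.sum_congr rfl fun d _ => by ring
  have hcoef : ∀ e : Fin (q + 1), ∀ y : F, y ^ q + y ≠ 0 →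
      ∑ d, g (e, d) * (p (d : ℕ)).eval y = 0 := by
    intro e y hy
    have hc : (y ^ q + y) ^ q = y ^ q + y := by
      have h := add_pow_char_pow (y ^ q) y 2 k
      rw [← hq] at h
      rw [h, ← pow_mul, ← sq, ← hF, FiniteField.pow_card, add_comm]
    exact eq_zero_of_sum_mul_pow_eq_zero _ (Finset.univ.filter fun x : F => x ^ (q + 1) = y ^ q + y)
      (card_norm_fiber hq2 hF hy hc) (fun x hx => hpt x y (by simpa using hx)) e
  rintro ⟨e, d⟩
  have hpoly : ∑ d : Fin (q ^ 2 - q), g (e, d) • p (d : ℕ) = 0 := by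
    refine eq_zero_of_natDegree_lt_card_of_eval_eq_zero' _
      (Finset.univ.filter fun y : F => y ^ q + y ≠ 0) (fun y hy => ?_) ?_
    · rw [eval_finsetSum]
      simpa using hcoef e y (by simpa using hy)
    · refine lt_of_lt_of_le ?_ (card_trace_ne_zero hq2 hF)
      have hpos : 0 < q ^ 2 - q := by
        have := d.2
        omega
      refine (natDegree_sum_le_of_forall_le (n := q ^ 2 - q - 1) _ _ fun d _ =>
        (natDegree_smul_le _ _).trans ?_).trans_lt (by omega)
      rw [p.natDegree_eq]
      omega
  exact Fintype.linearIndependent_iff.1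
    (p.linearIndependent.comp (fun d : Fin (q ^ 2 - q) => (d : ℕ)) Fin.val_injective)
    (fun d => g (e, d)) hpoly d

/-- The Hermitian lifted code. -/
def hermitianLiftedCode (q : ℕ) (F : Type*) [Field F] :
    Submodule F ({P : F × F // P.1 ^ (q + 1) = P.2 ^ q + P.2} → F) :=
  Submodule.span F {v | ∃ f : MvPolynomial (Fin 2) F, IsGoodPoly q f ∧
    v = fun P => MvPolynomial.eval ![P.val.1, P.val.2] f}

open Polynomial in
/-- The polynomial `X ^ (d % q) * (X ^ q) ^ (d / q)`, with the trace `X ^ q + X` in place of `X ^ q`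
when `d / q` is odd. -/
noncomputable def traceSequence {q : ℕ} (hq : 2 ≤ q) (F : Type*) [Field F] : Sequence F where
  elems' d := if Even (d / q) then X ^ d else X ^ (d % q) * (X ^ q + X) ^ (d / q)
  degree_eq' d := by
    split_ifs with h
    · simp
    · have hdeg : (X ^ q + X : F[X]).degree = q := by
        rw [degree_add_eq_left_of_degree_lt, degree_X_pow]
        rw [degree_X_pow, degree_X]
        exact_mod_cast hq
      rw [degree_mul, degree_pow, degree_pow, degree_X, hdeg]
      simp only [nsmul_eq_mul, mul_one]
      exact_mod_cast (by rw [mul_comm]; exact Nat.mod_add_div d q : d % q + d / q * q = d)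

open Polynomial in
lemma eval_traceSequence_of_even {q : ℕ} (hq : 2 ≤ q) {F : Type*} [Field F] {j n : ℕ} (hj : j < q)
    (hn : Even n) (y : F) : (traceSequence hq F (j + q * n)).eval y = y ^ (j + q * n) := by
  have hdiv : (j + q * n) / q = n := by
    rw [Nat.add_mul_div_left _ _ (by omega), Nat.div_eq_of_lt hj, zero_add]
  change (if Even ((j + q * n) / q) then _ else _ : F[X]).eval y = _
  rw [if_pos (by rwa [hdiv])]
  simp

open Polynomial in
lemma eval_traceSequence_of_odd {q : ℕ} (hq : 2 ≤ q) {F : Type*} [Field F] {j n : ℕ} (hj : j < q)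
    (hn : Odd n) (y : F) :
    (traceSequence hq F (j + q * n)).eval y = y ^ j * (y ^ q + y) ^ n := by
  have hdiv : (j + q * n) / q = n := by
    rw [Nat.add_mul_div_left _ _ (by omega), Nat.div_eq_of_lt hj, zero_add]
  have hmod : (j + q * n) % q = j := by
    rw [Nat.add_mul_mod_self_left, Nat.mod_eq_of_lt hj]
  change (if Even ((j + q * n) / q) then _ else _ : F[X]).eval y = _
  rw [hdiv, hmod, if_neg (Nat.not_even_iff_odd.2 hn)]
  simp

open Classical in
/-- The pairs `(e, j)` for which `x ^ e` times the member of `traceSequence` of degree `j + q * n`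
in `y` belongs to the Hermitian lifted code. -/
noncomputable def codeIndices {q : ℕ} (hq : 2 ≤ q) (F : Type*) [Field F] (n : ℕ) :
    Finset (ℕ × ℕ) :=
  (Finset.range (q + 1) ×ˢ Finset.range q).filter fun z => z.2 + q * n < q ^ 2 - q ∧
    (fun P => P.val.1 ^ z.1 * (traceSequence hq F (z.2 + q * n)).eval P.val.2) ∈
      hermitianLiftedCode q F

lemma sum_card_codeIndices_le_finrank {k q : ℕ} (hk : 1 ≤ k) (hqk : q = 2 ^ k) (hq : 2 ≤ q)
    {F : Type*} [Field F] [Fintype F] (hF : Fintype.card F = q ^ 2) :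
    ∑ n ∈ Finset.range q, (codeIndices hq F n).card ≤
      Module.finrank F (hermitianLiftedCode q F) := by
  classical
  rw [← Finset.card_sigma]
  set S := (Finset.range q).sigma fun n => codeIndices hq F n with hS
  have hmem : ∀ z ∈ S, z.2.1 < q + 1 ∧ z.2.2 < q ∧ z.2.2 + q * z.1 < q ^ 2 - q ∧
      (fun P : {P : F × F // P.1 ^ (q + 1) = P.2 ^ q + P.2} => P.val.1 ^ z.2.1 *
        (traceSequence hq F (z.2.2 + q * z.1)).eval P.val.2) ∈ hermitianLiftedCode q F := by
    intro z hz
    have := (Finset.mem_sigma.1 hz).2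
    simpa [codeIndices, and_assoc] using this
  let φ : S → Fin (q + 1) × Fin (q ^ 2 - q) := fun z =>
    (⟨z.1.2.1, (hmem z.1 z.2).1⟩, ⟨z.1.2.2 + q * z.1.1, (hmem z.1 z.2).2.2.1⟩)
  have hφ : Function.Injective φ := by
    rintro ⟨⟨n, e, j⟩, hz⟩ ⟨⟨n', e', j'⟩, hz'⟩ h
    have hj : j < q := (hmem _ hz).2.1
    have hj' : j' < q := (hmem _ hz').2.1
    simp only [φ, Prod.mk.injEq, Fin.mk.injEq] at h
    obtain ⟨rfl, h⟩ := h
    have hn := congrArg (· / q) h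
    simp only [Nat.add_mul_div_left _ _ (by omega : 0 < q), Nat.div_eq_of_lt hj,
      Nat.div_eq_of_lt hj', zero_add] at hn
    subst hn
    obtain rfl : j = j' := by omega
    rfl
  have hli := (linearIndependent_hermitian hk hqk hF (traceSequence hq F)).comp φ hφ
  have hli' : LinearIndependent F (fun z : S => (⟨_, (hmem z.1 z.2).2.2.2⟩ :
      hermitianLiftedCode q F)) :=
    LinearIndependent.of_comp (hermitianLiftedCode q F).subtype hli
  simpa using hli'.fintype_card_le_finrank

lemma mem_codeIndices_of_isGoodPoly {q : ℕ} (hq : 2 ≤ q) {F : Type*} [Field F] {n e j i l : ℕ}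
    (he : e ≤ q) (hj : j < q) (hn : n + 1 < q)
    (hgood : IsGoodPoly q (MvPolynomial.X 0 ^ i * MvPolynomial.X 1 ^ l : MvPolynomial (Fin 2) F))
    (heval : ∀ x y : F, x ^ (q + 1) = y ^ q + y →
      x ^ e * (traceSequence hq F (j + q * n)).eval y = x ^ i * y ^ l) :
    (e, j) ∈ codeIndices hq F n := by
  classical
  have hlt : j + q * n < q ^ 2 - q := by
    have : q * (n + 2) ≤ q * q := Nat.mul_le_mul_left _ (by omega)
    rw [mul_add] at this
    rw [sq]
    omega
  simp only [codeIndices, Finset.mem_filter, Finset.mem_product, Finset.mem_range]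
  refine ⟨⟨by omega, hj⟩, hlt, Submodule.subset_span ⟨_, hgood, ?_⟩⟩
  funext P
  simpa using heval P.val.1 P.val.2 P.2

open Polynomial in
lemma mem_codeIndices_zero {q : ℕ} (hq : 2 ≤ q) {F : Type*} [Field F] {e j : ℕ}
    (h : e + j < q) : (e, j) ∈ codeIndices hq F 0 := by
  refine mem_codeIndices_of_isGoodPoly hq (i := e) (l := j) (by omega) (by omega) (by omega)
    (fun a b _ => ⟨X ^ e * (C a * X + C b) ^ j, ?_, fun x y _ hy => by simp [hy]⟩)
    (fun x y _ => by rw [eval_traceSequence_of_even hq (by omega) (by simp)]; simp)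
  have h1 : (X ^ e * (C a * X + C b) ^ j : F[X]).natDegree ≤ e + j := by compute_degree
  exact (degree_le_of_natDegree_le h1).trans_lt (by exact_mod_cast h)

lemma mem_codeIndices_of_dvd {k q : ℕ} (hqk : q = 2 ^ k) (hq : 2 ≤ q) {F : Type*} [Field F]
    [Fintype F] (hF : Fintype.card F = q ^ 2) {n e j c : ℕ} (hn : 2 ^ (c + 1) ∣ n) (hnq : n < q)
    (he : e % 2 ^ (c + 1) < 2 ^ c) (hj : j % 2 ^ (c + 1) < 2 ^ c) (h : e + j + 2 ≤ q) :
    (e, j) ∈ codeIndices hq F n := by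
  have heven : Even n := even_iff_two_dvd.2 ((dvd_pow_self 2 c.succ_ne_zero).trans hn)
  have hqeven : Even q := by
    rw [hqk]
    refine (Nat.even_pow' ?_).2 even_two
    rintro rfl
    omega
  have hne : n + 1 ≠ q := by
    rintro rfl
    exact (Nat.even_add_one.1 hqeven) heven
  refine mem_codeIndices_of_isGoodPoly hq (by omega) (by omega) (by omega)
    (isGoodPoly_monomial hqk hF he hj h (dvd_zero _) hn (by omega)) (fun x y _ => ?_)
  rw [eval_traceSequence_of_even hq (by omega) heven]
  simp

lemma mem_codeIndices_odd {k m q : ℕ} (hqk : q = 2 ^ k) (hqm : q = 2 * m) (hq : 2 ≤ q) {F : Type*}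
    [Field F] [Fintype F] (hF : Fintype.card F = q ^ 2) {o a c : ℕ} (ha : a ≤ o)
    (hac : c + o + 1 < m) :
    (q + 2 * a - (2 * o + 1), 2 * c) ∈ codeIndices hq F (2 * o + 1) := by
  refine mem_codeIndices_of_isGoodPoly hq (i := 2 * a + q * (2 * (o + 1))) (l := 2 * c + q * 0)
    (by omega) (by omega) (by omega)
    (isGoodPoly_monomial hqk hF (c := 0) (by simp) (by simp) (by omega)
      (by simp) (by simp) (by omega)) (fun x y hxy => ?_)
  rw [eval_traceSequence_of_odd hq (by omega) (odd_two_mul_add_one o), ← hxy, ← pow_mul,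
    mul_left_comm, ← pow_add, mul_zero, add_zero, mul_comm]
  congr 2
  zify [show 2 * o + 1 ≤ q + 2 * a by omega]
  ring

lemma card_triangle (N : ℕ) :
    ((Finset.range N ×ˢ Finset.range N).filter fun z => z.1 + z.2 < N).card =
      (N + 1).choose 2 := by
  have h : ((Finset.range N ×ˢ Finset.range N).filter fun z => z.1 + z.2 < N) =
      (Finset.range N).biUnion fun s => Finset.HasAntidiagonal.antidiagonal s := by
    ext ⟨a, b⟩
    simp only [Finset.mem_filter, Finset.mem_product, Finset.mem_range, Finset.mem_biUnion,
      Finset.HasAntidiagonal.mem_antidiagonal, exists_eq_right']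
    omega
  rw [h, Finset.card_biUnion]
  · clear h
    simp only [Finset.Nat.card_antidiagonal]
    induction N with
    | zero => rfl
    | succ N ih =>
      rw [Finset.sum_range_succ, ih, Nat.choose_succ_succ' (N + 1) 1, Nat.choose_one_right,
        add_comm]
  · intro s _ t _ hst
    rw [Function.onFun, Finset.disjoint_left]
    rintro ⟨a, b⟩ h₁ h₂
    rw [Finset.HasAntidiagonal.mem_antidiagonal] at h₁ h₂
    omega

/-- The binary expansions of `x` and `y` have a common zero among the `r` lowest digits. -/
def HasCommonZeroDigit (r x y : ℕ) : Prop :=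
  ∃ c < r, x % 2 ^ (c + 1) < 2 ^ c ∧ y % 2 ^ (c + 1) < 2 ^ c

lemma HasCommonZeroDigit.of_lt {r x y : ℕ} (hx : x < 2 ^ r) (hy : y < 2 ^ r) :
    HasCommonZeroDigit (r + 1) x y :=
  ⟨r, r.lt_succ_self, (Nat.mod_le _ _).trans_lt hx, (Nat.mod_le _ _).trans_lt hy⟩

lemma HasCommonZeroDigit.of_modEq {r s x y x' y' : ℕ} (h : HasCommonZeroDigit r x y) (hrs : r ≤ s)
    (hx : x ≡ x' [MOD 2 ^ r]) (hy : y ≡ y' [MOD 2 ^ r]) : HasCommonZeroDigit s x' y' := by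
  obtain ⟨c, hc, h₁, h₂⟩ := h
  have hdvd : 2 ^ (c + 1) ∣ 2 ^ r := pow_dvd_pow 2 hc
  refine ⟨c, hc.trans_le hrs, ?_, ?_⟩
  · rwa [← hx.of_dvd hdvd]
  · rwa [← hy.of_dvd hdvd]

lemma modEq_add_pow (r x : ℕ) : x ≡ 2 ^ r + x [MOD 2 ^ r] := by
  simp [Nat.ModEq]

lemma HasCommonZeroDigit.of_add_lt {r x y : ℕ} (h : x + y + 1 < 2 ^ r) :
    HasCommonZeroDigit r x y := by
  induction r generalizing x y with
  | zero => omega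
  | succ r ih =>
    rw [pow_succ] at h
    by_cases hx : x < 2 ^ r
    · by_cases hy : y < 2 ^ r
      · exact .of_lt hx hy
      · obtain ⟨z, rfl⟩ := Nat.exists_eq_add_of_le (not_lt.1 hy)
        exact (ih (x := x) (y := z) (by omega)).of_modEq r.le_succ rfl (modEq_add_pow r z)
    · obtain ⟨z, rfl⟩ := Nat.exists_eq_add_of_le (not_lt.1 hx)
      exact (ih (x := z) (y := y) (by omega)).of_modEq r.le_succ (modEq_add_pow r z) rfl

open Classical in
lemma le_card_hasCommonZeroDigit (r : ℕ) :
    4 ^ r ≤ ((Finset.range (2 ^ r) ×ˢ Finset.range (2 ^ r)).filter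
      fun z => HasCommonZeroDigit r z.1 z.2).card + 3 ^ r := by
  induction r with
  | zero => simp
  | succ r ih =>
    rw [Finset.card_filter, Finset.sum_product] at ih ⊢
    set s := ∑ x ∈ Finset.range (2 ^ r), ∑ y ∈ Finset.range (2 ^ r),
      if HasCommonZeroDigit r x y then 1 else 0 with hs
    have key : ∀ f g : ℕ → ℕ, (∀ x, x ≡ f x [MOD 2 ^ r]) → (∀ x, x ≡ g x [MOD 2 ^ r]) →
        s ≤ ∑ x ∈ Finset.range (2 ^ r), ∑ y ∈ Finset.range (2 ^ r),
          if HasCommonZeroDigit (r + 1) (f x) (g y) then 1 else 0 := by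
      intro f g hf hg
      refine Finset.sum_le_sum fun x _ => Finset.sum_le_sum fun y _ => ?_
      by_cases h : HasCommonZeroDigit r x y
      · rw [if_pos h, if_pos (h.of_modEq r.le_succ (hf x) (hg y))]
      · simp [h]
    have h00 : ∑ x ∈ Finset.range (2 ^ r), ∑ y ∈ Finset.range (2 ^ r),
        (if HasCommonZeroDigit (r + 1) x y then 1 else 0) = 4 ^ r := by
      have : ∀ x ∈ Finset.range (2 ^ r), ∑ y ∈ Finset.range (2 ^ r),
          (if HasCommonZeroDigit (r + 1) x y then 1 else 0) = 2 ^ r := by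
        intro x hx
        rw [Finset.sum_congr rfl fun y hy => if_pos
          (HasCommonZeroDigit.of_lt (Finset.mem_range.1 hx) (Finset.mem_range.1 hy))]
        simp
      rw [Finset.sum_congr rfl this, Finset.sum_const, Finset.card_range, smul_eq_mul, ← mul_pow,
        show 2 * 2 = 4 from rfl]
    have h01 := key id (2 ^ r + ·) (fun _ => rfl) (modEq_add_pow r)
    have h10 := key (2 ^ r + ·) id (modEq_add_pow r) (fun _ => rfl)
    have h11 := key (2 ^ r + ·) (2 ^ r + ·) (modEq_add_pow r) (modEq_add_pow r)
    simp only [id] at h01 h10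
    simp only [pow_succ 2 r, mul_two, Finset.sum_range_add, Finset.sum_add_distrib]
    rw [h00, pow_succ 4, pow_succ 3]
    omega

lemma sum_range_two_pow_eq_sum_odd_multiples (f : ℕ → ℕ) (k : ℕ) :
    ∑ n ∈ Finset.range (2 ^ k), f n =
      f 0 + ∑ r ∈ Finset.range k, ∑ o ∈ Finset.range (2 ^ (k - 1 - r)), f (2 ^ r * (2 * o + 1)) := by
  induction k generalizing f with
  | zero => simp
  | succ k ih =>
    have hsplit : ∀ N, ∑ n ∈ Finset.range (2 * N), f n =
        ∑ n ∈ Finset.range N, f (2 * n) + ∑ n ∈ Finset.range N, f (2 * n + 1) := by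
      intro N
      induction N with
      | zero => simp
      | succ N ih =>
        rw [mul_add, mul_one, Finset.sum_range_succ, Finset.sum_range_succ, ih,
          Finset.sum_range_succ, Finset.sum_range_succ]
        ring
    rw [pow_succ', hsplit, ih fun n => f (2 * n), Finset.sum_range_succ']
    simp only [Nat.add_sub_cancel, mul_zero, Nat.sub_zero, pow_zero, one_mul, add_assoc]
    congr 2
    refine Finset.sum_congr rfl fun r _ => ?_
    rw [Nat.sub_sub, add_comm 1 r, pow_succ']
    simp only [mul_assoc]

open Classical in
lemma le_card_codeIndices_of_dvd {k q M r : ℕ} (hqk : q = 2 ^ k) (hq : 2 ≤ q)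
    (hM : M * 2 ^ r = q) {F : Type*} [Field F] [Fintype F] (hF : Fintype.card F = q ^ 2) {n : ℕ}
    (hn : 2 ^ r ∣ n) (hnq : n < q) :
    M.choose 2 * ((Finset.range (2 ^ r) ×ˢ Finset.range (2 ^ r)).filter
      fun z => HasCommonZeroDigit r z.1 z.2).card + M * (2 ^ r).choose 2 ≤
      (codeIndices hq F n).card := by
  have hM0 : 0 < M := Nat.pos_of_ne_zero fun h => by
    rw [h, zero_mul] at hM
    omega
  have hR0 : 0 < 2 ^ r := Nat.two_pow_pos r
  have hmodR : ∀ a i, i ≡ 2 ^ r * a + i [MOD 2 ^ r] := fun a i => by simp [Nat.ModEq]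
  have hmem : ∀ a b i j, HasCommonZeroDigit r i j → 2 ^ r * (a + b) + i + j + 2 ≤ q →
      (2 ^ r * a + i, 2 ^ r * b + j) ∈ codeIndices hq F n := by
    intro a b i j hij hle
    obtain ⟨c, hc, h₁, h₂⟩ := hij.of_modEq le_rfl (hmodR a i) (hmodR b j)
    refine mem_codeIndices_of_dvd hqk hq hF ((pow_dvd_pow 2 hc).trans hn) hnq h₁ h₂ ?_
    rw [mul_add] at hle
    omega
  generalize hR : 2 ^ r = R at *
  set L := (Finset.range R ×ˢ Finset.range R).filter fun z => HasCommonZeroDigit r z.1 z.2 with hL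
  set U := ((Finset.range (M - 1) ×ˢ Finset.range (M - 1)).filter
    fun z => z.1 + z.2 < M - 1) ×ˢ L with hU
  set V := (Finset.HasAntidiagonal.antidiagonal (M - 1)) ×ˢ
    ((Finset.range (R - 1) ×ˢ Finset.range (R - 1)).filter fun z => z.1 + z.2 < R - 1) with hV
  have hUV : Disjoint U V := by
    rw [Finset.disjoint_left]
    rintro ⟨⟨a, b⟩, i, j⟩ h₁ h₂
    simp only [hU, hV, Finset.mem_product, Finset.mem_filter,
      Finset.HasAntidiagonal.mem_antidiagonal] at h₁ h₂
    omega
  have hcard : (U ∪ V).card = M.choose 2 * L.card + M * R.choose 2 := by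
    rw [Finset.card_union_of_disjoint hUV, Finset.card_product, Finset.card_product, card_triangle,
      card_triangle, Finset.Nat.card_antidiagonal, Nat.sub_add_cancel hM0, Nat.sub_add_cancel hR0]
  have hlt : ∀ z ∈ U ∪ V, z.2.1 < R ∧ z.2.2 < R := by
    rintro ⟨⟨a, b⟩, i, j⟩ h
    rw [Finset.mem_union] at h
    rcases h with h | h
    · simp only [hU, hL, Finset.mem_product, Finset.mem_filter, Finset.mem_range] at h
      exact h.2.1
    · simp only [hV, Finset.mem_product, Finset.mem_filter, Finset.mem_range] at h
      dsimp only
      omega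
  rw [← hcard]
  refine Finset.card_le_card_of_injOn (fun z => (R * z.1.1 + z.2.1, R * z.1.2 + z.2.2)) ?_ ?_
  · rintro ⟨⟨a, b⟩, i, j⟩ h
    have hij := hlt _ h
    rw [Finset.mem_coe, Finset.mem_union] at h
    rcases h with h | h
    · simp only [hU, hL, Finset.mem_product, Finset.mem_filter, Finset.mem_range] at h
      refine hmem a b i j h.2.2 ?_
      have := Nat.mul_le_mul_left R (show a + b + 2 ≤ M by omega)
      rw [mul_add, mul_comm R M, hM] at this
      dsimp only at hij
      omega
    · simp only [hV, Finset.mem_product, Finset.mem_filter, Finset.mem_range,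
        Finset.HasAntidiagonal.mem_antidiagonal] at h
      refine hmem a b i j (.of_add_lt (by rw [hR]; omega)) ?_
      have := congrArg (R * ·) (show a + b + 1 = M by omega)
      simp only [mul_add, mul_one, mul_comm R M, hM] at this
      rw [mul_add]
      omega
  · rintro ⟨⟨a, b⟩, i, j⟩ h ⟨⟨a', b'⟩, i', j'⟩ h' heq
    obtain ⟨hi, hj⟩ := hlt _ h
    obtain ⟨hi', hj'⟩ := hlt _ h'
    simp only [Prod.mk.injEq] at heq hi hj hi' hj' ⊢
    have hdiv : ∀ {a i a' i'}, i < R → i' < R → R * a + i = R * a' + i' → a = a' ∧ i = i' := by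
      intro a i a' i' hi hi' h
      have := congrArg (· / R) h
      simp only [Nat.mul_add_div hR0, Nat.div_eq_of_lt hi, Nat.div_eq_of_lt hi', add_zero] at this
      subst this
      exact ⟨rfl, by omega⟩
    have h₁ := hdiv hi hi' heq.1
    have h₂ := hdiv hj hj' heq.2
    exact ⟨⟨h₁.1, h₂.1⟩, h₁.2, h₂.2⟩

lemma le_card_codeIndices_zero {q : ℕ} (hq : 2 ≤ q) (F : Type*) [Field F] :
    (q + 1).choose 2 ≤ (codeIndices hq F 0).card := by
  rw [← card_triangle]
  exact Finset.card_le_card fun z hz => mem_codeIndices_zero hq (Finset.mem_filter.1 hz).2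

lemma le_card_codeIndices_odd {k m q : ℕ} (hqk : q = 2 ^ k) (hqm : q = 2 * m) (hq : 2 ≤ q)
    {F : Type*} [Field F] [Fintype F] (hF : Fintype.card F = q ^ 2) (o : ℕ) :
    (o + 1) * (m - 1 - o) ≤ (codeIndices hq F (2 * o + 1)).card := by
  have hcard : (Finset.range (o + 1) ×ˢ Finset.range (m - 1 - o)).card =
      (o + 1) * (m - 1 - o) := by
    simp
  rw [← hcard]
  refine Finset.card_le_card_of_injOn (fun z => (q + 2 * z.1 - (2 * o + 1), 2 * z.2)) ?_ ?_
  · rintro ⟨a, c⟩ h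
    simp only [Finset.coe_product, Set.mem_prod, Finset.mem_coe, Finset.mem_range] at h
    exact mem_codeIndices_odd hqk hqm hq hF (by omega) (by omega)
  · rintro ⟨a, c⟩ h ⟨a', c'⟩ h' heq
    simp only [Finset.coe_product, Set.mem_prod, Finset.mem_coe, Finset.mem_range] at h h'
    simp only [Prod.mk.injEq] at heq ⊢
    omega

lemma sum_mul_tsub_eq (m : ℕ) :
    ((∑ o ∈ Finset.range m, (o + 1) * (m - 1 - o) : ℕ) : ℚ) = (m ^ 3 - m) / 6 := by
  have h : ∀ n : ℕ, ∑ o ∈ Finset.range n, ((o : ℚ) + 1) * (m - 1 - o) =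
      (n * (n + 1) / 2) * m - n * (n + 1) * (2 * n + 1) / 6 := by
    intro n
    induction n with
    | zero => simp
    | succ n ih =>
      rw [Finset.sum_range_succ, ih]
      push_cast
      ring
  rw [show ((m : ℚ) ^ 3 - m) / 6 = (m * (m + 1) / 2) * m - m * (m + 1) * (2 * m + 1) / 6 by ring,
    ← h m]
  push_cast
  refine Finset.sum_congr rfl fun o ho => ?_
  have := Finset.mem_range.1 ho
  rw [Nat.sub_sub, Nat.cast_sub (by omega)]
  push_cast
  ring

lemma sum_Icc_lower_bound_eq (K : ℕ) :
    ∑ r ∈ Finset.Icc 1 (K + 1), ((2 ^ (K + 1) : ℕ) : ℚ) / 2 ^ (r + 1) *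
      ((Nat.choose (2 ^ (K + 1) / 2 ^ r) 2 : ℚ) * (4 ^ r - 3 ^ r)
        + (2 ^ (K + 1) / 2 ^ r : ℕ) * (Nat.choose (2 ^ r + 1) 2 : ℚ)) =
    ∑ r ∈ Finset.range K, (2 : ℚ) ^ (K - (r + 1)) *
      ((Nat.choose (2 ^ (K - r)) 2 : ℚ) * (4 ^ (r + 1) - 3 ^ (r + 1))
        + 2 ^ (K - r) * (Nat.choose (2 ^ (r + 1)) 2 : ℚ)) +
    3 * 2 ^ K * (2 * 2 ^ K - 1) / 2 := by
  have hterm : ∀ r ∈ Finset.range K, ((2 ^ (K + 1) : ℕ) : ℚ) / 2 ^ (r + 1 + 1) *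
      ((Nat.choose (2 ^ (K + 1) / 2 ^ (r + 1)) 2 : ℚ) * (4 ^ (r + 1) - 3 ^ (r + 1))
        + (2 ^ (K + 1) / 2 ^ (r + 1) : ℕ) * (Nat.choose (2 ^ (r + 1) + 1) 2 : ℚ)) =
      (2 : ℚ) ^ (K - (r + 1)) *
      ((Nat.choose (2 ^ (K - r)) 2 : ℚ) * (4 ^ (r + 1) - 3 ^ (r + 1))
        + 2 ^ (K - r) * (Nat.choose (2 ^ (r + 1)) 2 : ℚ)) + (2 ^ K) ^ 2 * (1 / 2 ^ r) := by
    intro r hr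
    obtain ⟨t, rfl⟩ : ∃ t, K = r + 1 + t :=
      Nat.exists_eq_add_of_le (Nat.succ_le_of_lt (Finset.mem_range.1 hr))
    have h1 : 2 ^ (r + 1 + t + 1) / 2 ^ (r + 1) = 2 ^ (t + 1) := by
      rw [Nat.pow_div (by omega) two_pos]
      congr 1
      omega
    have h2 : r + 1 + t - r = t + 1 := by omega
    have h3 : r + 1 + t - (r + 1) = t := by omega
    rw [h1, h2, h3, Nat.choose_succ_succ' (2 ^ (r + 1)) 1, Nat.choose_one_right]
    push_cast
    have h4 : (2 : ℚ) ^ r ≠ 0 := by positivity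
    simp only [pow_add, pow_one]
    field_simp
    ring
  have hgeom : ∑ r ∈ Finset.range K, (1 / 2 ^ r : ℚ) = 2 - 2 / 2 ^ K := by
    clear hterm
    induction K with
    | zero => simp
    | succ K ih =>
      rw [Finset.sum_range_succ, ih, pow_succ]
      field_simp
      ring
  rw [← Finset.Ico_add_one_right_eq_Icc, Finset.sum_Ico_eq_sum_range, Nat.add_sub_cancel,
    Finset.sum_range_succ]
  simp only [add_comm 1]
  rw [Finset.sum_congr rfl hterm, Finset.sum_add_distrib, ← Finset.mul_sum, hgeom, Nat.div_self
    (Nat.two_pow_pos _), add_assoc]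
  congr 1
  have h0 : (2 : ℚ) ^ K ≠ 0 := by positivity
  rw [Nat.choose_eq_zero_of_lt one_lt_two, Nat.cast_choose_two]
  push_cast
  simp only [pow_succ]
  field_simp
  ring

/-- The dimension `K` of the Hermitian lifted code (the span of the evaluations on the Hermitian
curve of all good polynomials) satisfies
`K ≥ Σ_{r=1}^{k} (q/2^{r+1})·( C(q/2^r, 2)·(4^r - 3^r) + (q/2^r)·C(2^r + 1, 2) )`. -/
theorem hermitian_lifted_code_dim_ge (k : ℕ) (hk : 1 ≤ k) (q : ℕ) (hq : q = 2 ^ k)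
    (F : Type*) [Field F] [Fintype F] (hF : Fintype.card F = q ^ 2) :
    ((Module.finrank F ↥(Submodule.span F
        {v : {p : F × F // p.1 ^ (q + 1) = p.2 ^ q + p.2} → F |
          ∃ f : MvPolynomial (Fin 2) F, IsGoodPoly q f ∧
            v = fun p => MvPolynomial.eval ![p.val.1, p.val.2] f})) : ℚ)
      ≥ ∑ r ∈ Finset.Icc 1 k, (q : ℚ) / 2 ^ (r + 1) *
          ((Nat.choose (q / 2 ^ r) 2 : ℚ) * (4 ^ r - 3 ^ r)
            + (q / 2 ^ r : ℕ) * (Nat.choose (2 ^ r + 1) 2 : ℚ)) := by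
  classical
  obtain ⟨K, rfl⟩ : ∃ K, k = K + 1 := ⟨k - 1, by omega⟩
  have hq2 : 2 ≤ q := by
    rw [hq]
    exact Nat.le_self_pow (by omega) 2
  have hqm : q = 2 * 2 ^ K := by rw [hq, pow_succ']
  have hrank := sum_card_codeIndices_le_finrank hk hq hq2 hF
  change ((Module.finrank F (hermitianLiftedCode q F) : ℕ) : ℚ) ≥ _
  refine le_trans ?_ (Nat.cast_le.2 hrank)
  rw [show Finset.range q = Finset.range (2 ^ (K + 1)) by rw [hq],
    sum_range_two_pow_eq_sum_odd_multiples, Finset.sum_range_succ', Nat.add_sub_cancel]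
  have hzero := le_card_codeIndices_zero hq2 F
  have hodd : ∑ o ∈ Finset.range (2 ^ K), (o + 1) * (2 ^ K - 1 - o) ≤
      ∑ o ∈ Finset.range (2 ^ (K - 0)), (codeIndices hq2 F (2 ^ 0 * (2 * o + 1))).card := by
    rw [Nat.sub_zero]
    refine Finset.sum_le_sum fun o _ => ?_
    rw [pow_zero, one_mul]
    exact le_card_codeIndices_odd hq hqm hq2 hF o
  have heven : ∑ r ∈ Finset.range K, (2 : ℚ) ^ (K - (r + 1)) *
      ((Nat.choose (2 ^ (K - r)) 2 : ℚ) * (4 ^ (r + 1) - 3 ^ (r + 1))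
        + 2 ^ (K - r) * (Nat.choose (2 ^ (r + 1)) 2 : ℚ)) ≤
      ((∑ r ∈ Finset.range K, ∑ o ∈ Finset.range (2 ^ (K - (r + 1))),
        (codeIndices hq2 F (2 ^ (r + 1) * (2 * o + 1))).card : ℕ) : ℚ) := by
    rw [Nat.cast_sum]
    refine Finset.sum_le_sum fun r hr => ?_
    have hr := Finset.mem_range.1 hr
    have hpow : 2 ^ (K - r) * 2 ^ (r + 1) = q := by
      rw [hq, ← pow_add]
      congr 1
      omega
    have hpow' : 2 ^ (r + 1) * (2 * 2 ^ (K - (r + 1))) = q := by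
      rw [hq, ← pow_succ', ← pow_add]
      congr 1
      omega
    have hterm := fun o (ho : o ∈ Finset.range (2 ^ (K - (r + 1)))) =>
      le_card_codeIndices_of_dvd hq hq2 hpow hF (Dvd.intro (2 * o + 1) rfl)
        (show 2 ^ (r + 1) * (2 * o + 1) < q by
          have := Finset.mem_range.1 ho
          refine lt_of_lt_of_eq ?_ hpow'
          exact Nat.mul_lt_mul_of_pos_left (by omega) (Nat.two_pow_pos _))
    have hsum := Finset.sum_le_sum hterm
    rw [Finset.sum_const, Finset.card_range, smul_eq_mul] at hsum
    refine le_trans ?_ (Nat.cast_le.2 hsum)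
    have hlow := le_card_hasCommonZeroDigit (r + 1)
    have hlow' : (4 : ℚ) ^ (r + 1) - 3 ^ (r + 1) ≤
        (((Finset.range (2 ^ (r + 1)) ×ˢ Finset.range (2 ^ (r + 1))).filter
          fun z => HasCommonZeroDigit (r + 1) z.1 z.2).card : ℚ) := by
      rw [sub_le_iff_le_add]
      exact_mod_cast hlow
    push_cast
    gcongr
  have hodd' : (((2 : ℚ) ^ K) ^ 3 - 2 ^ K) / 6 ≤
      ((∑ o ∈ Finset.range (2 ^ (K - 0)),
        (codeIndices hq2 F (2 ^ 0 * (2 * o + 1))).card : ℕ) : ℚ) := by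
    refine le_trans (le_of_eq ?_) (Nat.cast_le.2 hodd)
    rw [sum_mul_tsub_eq]
    push_cast
    rfl
  have hzero' : (2 : ℚ) ^ K * (2 * 2 ^ K + 1) ≤ ((codeIndices hq2 F 0).card : ℚ) := by
    refine le_trans (le_of_eq ?_) (Nat.cast_le.2 hzero)
    rw [Nat.cast_choose_two, hqm]
    push_cast
    ring
  have hlhs := sum_Icc_lower_bound_eq K
  rw [← hq] at hlhs
  rw [hlhs, Nat.cast_add, Nat.cast_add]
  have hm : (0 : ℚ) < 2 ^ K := by positivity
  nlinarith [mul_nonneg hm.le (sq_nonneg ((2 : ℚ) ^ K - 3))]
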